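/- Let N, L be positive integers, Δ > 0 a real number, and let A ∈ ℂ^{N×N} be diagonalizable as A = V·Λ·V^{−1} where Λ = diag(λ_1, …, λ_N) and every eigenvalue satisfies λ_i ≠ 0. Let B ∈ ℂ^N be a column vector and C ∈ ℂ^N a row vector, and define w̃ ∈ ℂ^N by w̃_i = (C·V)_i · (V^{−1}·B)_i. Then for every 0 ≤ k < L, K̄_{Δ,L}(A, B, C)_k = K̄_{Δ,L}(Λ, 𝟙, w̃)_k, where 𝟙 = (1, …, 1)^T ∈ ℂ^N; that is, the kernel of the general state space (A, B, C) equals the kernel of the diagonal state space (Λ, 𝟙, w̃). -/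

import Mathlib

open Matrix NormedSpace Finset

/-- The SSM kernel `K̄_{Δ,L}(A,B,C)_k = C · exp(kΔA) · (exp(ΔA) − I) · A⁻¹ · B`,
as a function of the position `k` (positions `0 ≤ k < L` are the entries of the kernel). -/
noncomputable def ssmKernel {N : ℕ} (Δ : ℝ) (A : Matrix (Fin N) (Fin N) ℂ)
    (B C : Fin N → ℂ) (k : ℕ) : ℂ :=
  C ⬝ᵥ ((exp (((k : ℂ) * (Δ : ℂ)) • A) * (exp ((Δ : ℂ) • A) - 1) * A⁻¹) *ᵥ B)

/-- The kernel is invariant under the change of basis `(A, B, C) ↦ (V A V⁻¹, V B, C V⁻¹)`. -/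
theorem ssmKernel_conj {N : ℕ} (Δ : ℝ) (V A : Matrix (Fin N) (Fin N) ℂ) (hV : IsUnit V)
    (B C : Fin N → ℂ) (k : ℕ) :
    ssmKernel Δ (V * A * V⁻¹) B C k = ssmKernel Δ A (V⁻¹ *ᵥ B) (C ᵥ* V) k := by
  have hdet : IsUnit V.det := (Matrix.isUnit_iff_isUnit_det V).mp hV
  have exp_smul_conj (c : ℂ) : exp (c • (V * A * V⁻¹)) = V * exp (c • A) * V⁻¹ := by
    rw [← Matrix.exp_conj _ _ hV, Matrix.mul_smul, Matrix.smul_mul]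
  have sub_one_conj (X : Matrix (Fin N) (Fin N) ℂ) :
      V * X * V⁻¹ - 1 = V * (X - 1) * V⁻¹ := by
    rw [mul_sub, sub_mul, mul_one, Matrix.mul_nonsing_inv _ hdet]
  have mul_conj (X Y : Matrix (Fin N) (Fin N) ℂ) :
      V * X * V⁻¹ * (V * Y * V⁻¹) = V * (X * Y) * V⁻¹ := by
    simp only [Matrix.mul_assoc, Matrix.nonsing_inv_mul_cancel_left _ _ hdet]
  have inv_conj : (V * A * V⁻¹)⁻¹ = V * A⁻¹ * V⁻¹ := by
    rw [Matrix.mul_inv_rev, Matrix.mul_inv_rev, Matrix.nonsing_inv_nonsing_inv _ hdet,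
      Matrix.mul_assoc]
  simp only [ssmKernel, exp_smul_conj, sub_one_conj, inv_conj, mul_conj]
  rw [← Matrix.mulVec_mulVec, ← Matrix.mulVec_mulVec, Matrix.dotProduct_mulVec]

/-- For a diagonal state matrix the kernel depends on `B` and `C` only through their
entrywise product. -/
theorem ssmKernel_diagonal {N : ℕ} (Δ : ℝ) (lam B C : Fin N → ℂ) (k : ℕ) :
    ssmKernel Δ (Matrix.diagonal lam) B C k =
      ssmKernel Δ (Matrix.diagonal lam) (fun _ => 1) (fun i => C i * B i) k := by
  simp only [ssmKernel, ← Matrix.diagonal_smul, Matrix.exp_diagonal, Matrix.inv_diagonal,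
    ← Matrix.diagonal_one, Matrix.diagonal_sub, Matrix.diagonal_mul_diagonal, dotProduct,
    Matrix.mulVec_diagonal]
  exact Finset.sum_congr rfl fun i _ => by ring

theorem dss_kernel_part_a {N L : ℕ} (hN : 0 < N) (hL : 0 < L) (Δ : ℝ) (hΔ : 0 < Δ)
    (A V : Matrix (Fin N) (Fin N) ℂ) (hV : IsUnit V)
    (lam : Fin N → ℂ) (hlam : ∀ i, lam i ≠ 0)
    (hA : A = V * Matrix.diagonal lam * V⁻¹)
    (B C : Fin N → ℂ) (wt : Fin N → ℂ)
    (hwt : ∀ i, wt i = (V.vecMul C) i * (V⁻¹ *ᵥ B) i) :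
    ∀ k < L, ssmKernel Δ A B C k =
      ssmKernel Δ (Matrix.diagonal lam) (fun _ => 1) wt k := by
  intro k _
  rw [hA, ssmKernel_conj Δ V _ hV, ssmKernel_diagonal, funext hwt]
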